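/- arXiv:2508.00004 — 4 statements merged into one kernel-verified Lean document; each statement's English description precedes it below -/
import Mathlib

section
/- For every k-sight model M, situation σ, variable z ∈ {x,y}, m-ary predicate P, and terms t1,...,tm with {t1,...,tm} ⊆ T ⊆ Cons ∪ Var, the formula (K_z T ∧ P(t1,...,tm)) → K_z P(t1,...,tm) is true at M, σ, where K_z T abbreviates ⋀_{t∈T} K_z t. Hence this schema is valid on k-sight models. -/
/-! Core definitions for the Epistemic Logic of Cops and Robbers (ELCR). -/

/-- The two players/variables. -/
inductive Var : Type
  | x | y
  deriving DecidableEq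

/-- The other variable. -/
def Var.other : Var → Var
  | .x => .y
  | .y => .x

/-- Terms: constants or variables. -/
inductive Term (Cons : Type) : Type
  | const (c : Cons)
  | var (v : Var)
  deriving DecidableEq

/-- Formulas of the full language `L` (with movement modalities). -/
inductive Form (Pred Cons : Type) : Type
  | pred (P : Pred) (args : List (Term Cons))
  | rel (t₁ t₂ : Term Cons)
  | eq (t₁ t₂ : Term Cons)
  | neg (φ : Form Pred Cons)
  | and (φ ψ : Form Pred Cons)
  | Kt (z : Var) (t : Term Cons)
  | K (z : Var) (φ : Form Pred Cons)
  | box (z : Var) (φ : Form Pred Cons)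

namespace Form

variable {Pred Cons : Type}

def imp (φ ψ : Form Pred Cons) : Form Pred Cons := .neg (.and φ (.neg ψ))
def or (φ ψ : Form Pred Cons) : Form Pred Cons := .neg (.and (.neg φ) (.neg ψ))
def iffF (φ ψ : Form Pred Cons) : Form Pred Cons := .and (imp φ ψ) (imp ψ φ)
def falseF : Form Pred Cons := .neg (.eq (.var .x) (.var .x))
def trueF : Form Pred Cons := .neg falseF
/-- `⟨K_z⟩φ := ¬K_z¬φ`. -/
def diaK (z : Var) (φ : Form Pred Cons) : Form Pred Cons := .neg (.K z (.neg φ))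

def bigAnd : List (Form Pred Cons) → Form Pred Cons
  | [] => trueF
  | φ :: l => .and φ (bigAnd l)

def bigOr : List (Form Pred Cons) → Form Pred Cons
  | [] => falseF
  | φ :: l => or φ (bigOr l)

/-- Membership in the Boolean base language `L_B`. -/
def isBase : Form Pred Cons → Prop
  | .pred _ _ => True
  | .rel _ _ => True
  | .eq _ _ => True
  | .neg φ => isBase φ
  | .and φ ψ => isBase φ ∧ isBase ψ
  | .Kt _ _ => False
  | .K _ _ => False
  | .box _ _ => False

/-- Membership in `L_BD` (Booleans plus movement modalities). -/
def isBD : Form Pred Cons → Prop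
  | .pred _ _ => True
  | .rel _ _ => True
  | .eq _ _ => True
  | .neg φ => isBD φ
  | .and φ ψ => isBD φ ∧ isBD ψ
  | .Kt _ _ => False
  | .K _ _ => False
  | .box _ φ => isBD φ

/-- Membership in the full language `L`. -/
def isL : Form Pred Cons → Prop
  | .pred _ _ => True
  | .rel _ _ => True
  | .eq _ _ => True
  | .neg φ => isL φ
  | .and φ ψ => isL φ ∧ isL ψ
  | .Kt _ _ => True
  | .K _ ψ => isBD ψ
  | .box _ φ => isL φ

/-- Membership in the static fragment `L⁻`: no movement modalities, and the
knowledge operator `K_z` is applied to `L_B`-formulas only. -/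
def isStatic : Form Pred Cons → Prop
  | .pred _ _ => True
  | .rel _ _ => True
  | .eq _ _ => True
  | .neg φ => isStatic φ
  | .and φ ψ => isStatic φ ∧ isStatic ψ
  | .Kt _ _ => True
  | .K _ φ => isBase φ
  | .box _ _ => False

/-- The variable `z` occurs in the formula. -/
def occurs (z : Var) : Form Pred Cons → Prop
  | .pred _ args => Term.var z ∈ args
  | .rel t₁ t₂ => t₁ = Term.var z ∨ t₂ = Term.var z
  | .eq t₁ t₂ => t₁ = Term.var z ∨ t₂ = Term.var z
  | .neg φ => occurs z φ
  | .and φ ψ => occurs z φ ∨ occurs z ψ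
  | .Kt w t => w = z ∨ t = Term.var z
  | .K w φ => w = z ∨ occurs z φ
  | .box w φ => w = z ∨ occurs z φ

/-- The list of terms occurring in a formula. -/
def termList : Form Pred Cons → List (Term Cons)
  | .pred _ args => args
  | .rel t₁ t₂ => [t₁, t₂]
  | .eq t₁ t₂ => [t₁, t₂]
  | .neg φ => termList φ
  | .and φ ψ => termList φ ++ termList ψ
  | .Kt _ t => [t]
  | .K _ φ => termList φ
  | .box _ φ => termList φ

end Form

/-- Substituting the constant `c` for the variable `z` in a term. -/
def Term.substC {Cons : Type} (c : Cons) (z : Var) : Term Cons → Term Cons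
  | .var v => if v = z then .const c else .var v
  | .const c' => .const c'

/-- `φ.substC c z` is `φ[c/z]`. -/
def Form.substC {Pred Cons : Type} (c : Cons) (z : Var) : Form Pred Cons → Form Pred Cons
  | .pred P args => .pred P (args.map (Term.substC c z))
  | .rel t₁ t₂ => .rel (t₁.substC c z) (t₂.substC c z)
  | .eq t₁ t₂ => .eq (t₁.substC c z) (t₂.substC c z)
  | .neg φ => .neg (φ.substC c z)
  | .and φ ψ => .and (φ.substC c z) (ψ.substC c z)
  | .Kt w t => .Kt w (t.substC c z)
  | .K w φ => .K w (φ.substC c z)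
  | .box w φ => .box w (φ.substC c z)

/-- Replacing the term `t₂` by the term `t₁`. -/
def Term.repl {Cons : Type} [DecidableEq Cons] (t₁ t₂ t : Term Cons) : Term Cons :=
  if t = t₂ then t₁ else t

/-- `φ.replace t₁ t₂` is `φ[t₁/t₂]`: the result of replacing `t₂` in `φ` with `t₁`. -/
def Form.replace {Pred Cons : Type} [DecidableEq Cons] (t₁ t₂ : Term Cons) :
    Form Pred Cons → Form Pred Cons
  | .pred P args => .pred P (args.map (Term.repl t₁ t₂))
  | .rel s₁ s₂ => .rel (Term.repl t₁ t₂ s₁) (Term.repl t₁ t₂ s₂)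
  | .eq s₁ s₂ => .eq (Term.repl t₁ t₂ s₁) (Term.repl t₁ t₂ s₂)
  | .neg φ => .neg (φ.replace t₁ t₂)
  | .and φ ψ => .and (φ.replace t₁ t₂) (ψ.replace t₁ t₂)
  | .Kt w t => .Kt w (Term.repl t₁ t₂ t)
  | .K w φ => .K w (φ.replace t₁ t₂)
  | .box w φ => .box w (φ.replace t₁ t₂)

/-- The list of all terms (constants and variables), for finite `Cons`. -/
noncomputable def allTerms (Cons : Type) [Fintype Cons] : List (Term Cons) :=
  (Finset.univ : Finset Cons).toList.map Term.const ++ [Term.var .x, Term.var .y]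

/-- The syntactic distance formulas `D^n t₁ t₂`. -/
noncomputable def distForm (Pred : Type) {Cons : Type} [Fintype Cons] :
    ℕ → Term Cons → Term Cons → Form Pred Cons
  | 0, t₁, t₂ => .eq t₁ t₂
  | n + 1, t₁, t₂ =>
      Form.or (distForm Pred n t₁ t₂)
        (Form.bigOr ((allTerms Cons).map fun t =>
          Form.and (distForm Pred n t₁ t) (Form.or (.rel t t₂) (.rel t₂ t))))

/-- `K_z z' = T`: the set `T` consists of the possible positions of `z'` considered by `z`. -/
noncomputable def KzEqSet {Pred Cons : Type} [Fintype Cons] [DecidableEq Cons]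
    (z z' : Var) (T : Finset Cons) : Form Pred Cons :=
  Form.bigAnd
    ((T.toList.map fun c => Form.diaK z (.eq (.var z') (.const c))) ++
      (Tᶜ.toList.map fun c => Form.K z (.neg (.eq (.var z') (.const c)))))

/-- `Rz = T`: `T` is exactly the set of (names of) R-successors of `z`. -/
noncomputable def RzEqSet {Pred Cons : Type} [Fintype Cons] [DecidableEq Cons]
    (z : Var) (T : Finset Cons) : Form Pred Cons :=
  Form.bigAnd
    ((T.toList.map fun c => Form.rel (.var z) (.const c)) ++
      (Tᶜ.toList.map fun c => Form.neg (Form.rel (.var z) (.const c))))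

/-- The list of all subsets of `Cons`. -/
noncomputable def powList (Cons : Type) [Fintype Cons] [DecidableEq Cons] : List (Finset Cons) :=
  (Finset.univ : Finset Cons).powerset.toList

/-! ### Semantics -/

/-- An interpretation of the vocabulary over a domain `D`. -/
structure Interp (Pred Cons D : Type) where
  pred : Pred → List D → Prop
  rel : D → D → Prop
  const : Cons → D

/-- Assignments (situations): positions of the two players. -/
abbrev Assign (D : Type) := Var → D

/-- The value of a term at an interpretation and a situation. -/
def Term.val {Pred Cons D : Type} (I : Interp Pred Cons D) (σ : Assign D) :
    Term Cons → D
  | .const c => I.const c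
  | .var v => σ v

/-- `Dball I m s` is `D^m(s)`: points reachable from `s` in at most `m` steps
along `I.rel` or its converse. -/
def Dball {Pred Cons D : Type} (I : Interp Pred Cons D) : ℕ → D → Set D
  | 0, s => {s}
  | m + 1, s => Dball I m s ∪ {t | ∃ u ∈ Dball I m s, I.rel u t ∨ I.rel t u}

/-- `R^z σ σ'`: player `z` moves along an arrow, the other player stays put. -/
def Rstep {Pred Cons D : Type} (I : Interp Pred Cons D) (z : Var) (σ σ' : Assign D) : Prop :=
  I.rel (σ z) (σ' z) ∧ σ z.other = σ' z.other

/-- Indistinguishability data: a relation on assignments for each player. -/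
abbrev SimRel (D : Type) := Var → Assign D → Assign D → Prop

/-- `Σ|σ`: the situations related to `σ` by some player's indistinguishability. -/
def restrict {D : Type} (Sit : Set (Assign D)) (sim : SimRel D) (σ : Assign D) :
    Set (Assign D) :=
  {σ' ∈ Sit | ∃ z, sim z σ σ'}

/-- The updated set of situations after player `z` moves from `σ₁` to `σ₂`. -/
def updSit {Pred Cons D : Type} (k : ℕ) (I : Interp Pred Cons D)
    (Sit : Set (Assign D)) (sim : SimRel D) (z : Var) (σ₁ σ₂ : Assign D) :
    Set (Assign D) :=
  {σ' | (σ₂ Var.x ∈ Dball I k (σ₂ Var.y) ∧ σ' = σ₂) ∨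
        (σ₂ Var.x ∉ Dball I k (σ₂ Var.y) ∧
          (∃ σ ∈ restrict Sit sim σ₁, Rstep I z σ σ') ∧
          σ' Var.x ∉ Dball I k (σ' Var.y))}

/-- The updated indistinguishability relations: `σ₁ ∼'_z σ₂` iff `σ₁ z = σ₂ z`. -/
def updSim (D : Type) : SimRel D := fun z σ₁ σ₂ => σ₁ z = σ₂ z

/-- Satisfaction for `ELCR` (with sight `k`). -/
def Sat {Pred Cons D : Type} (k : ℕ) (I : Interp Pred Cons D) :
    Set (Assign D) → SimRel D → Assign D → Form Pred Cons → Prop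
  | _, _, σ, .pred P args => I.pred P (args.map (Term.val I σ))
  | _, _, σ, .rel t₁ t₂ => I.rel (t₁.val I σ) (t₂.val I σ)
  | _, _, σ, .eq t₁ t₂ => t₁.val I σ = t₂.val I σ
  | Sit, sim, σ, .neg φ => ¬ Sat k I Sit sim σ φ
  | Sit, sim, σ, .and φ ψ => Sat k I Sit sim σ φ ∧ Sat k I Sit sim σ ψ
  | Sit, sim, σ, .Kt z t => ∀ σ' ∈ Sit, sim z σ' σ → t.val I σ = t.val I σ'
  | Sit, sim, σ, .K z φ => ∀ σ' ∈ Sit, sim z σ' σ → Sat k I Sit sim σ' φ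
  | Sit, sim, σ, .box z φ => ∀ σ₂, Rstep I z σ σ₂ →
      Sat k I (updSit k I Sit sim z σ σ₂) (updSim D) σ₂ φ

/-- The conditions making `(D, I, Σ, ∼)` a model: seriality of `I.rel`, every
point named by a constant, `Σ` nonempty, and each `∼_z` an equivalence relation on `Σ`. -/
structure IsModel {Pred Cons D : Type} (I : Interp Pred Cons D)
    (Sit : Set (Assign D)) (sim : SimRel D) : Prop where
  serial : ∀ s, ∃ t, I.rel s t
  const_surj : Function.Surjective I.const
  nonempty : Sit.Nonempty
  sim_mem : ∀ z σ σ', sim z σ σ' → σ ∈ Sit ∧ σ' ∈ Sit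
  sim_refl : ∀ z, ∀ σ ∈ Sit, sim z σ σ
  sim_symm : ∀ z σ σ', sim z σ σ' → sim z σ' σ
  sim_trans : ∀ z σ₁ σ₂ σ₃, sim z σ₁ σ₂ → sim z σ₂ σ₃ → sim z σ₁ σ₃

/-- The `k`-sight condition. -/
def KSight {Pred Cons D : Type} (k : ℕ) (I : Interp Pred Cons D)
    (Sit : Set (Assign D)) (sim : SimRel D) : Prop :=
  ∀ z σ σ', σ ∈ Sit → σ' ∈ Sit → sim z σ σ' →
    ∀ z', σ z' ∈ Dball I k (σ z) → σ z' = σ' z'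

/-- A nonempty conjunction `K_zα₁ ∧ ⋯ ∧ K_zαₙ ∧ ⟨K_z⟩β₁ ∧ ⋯ ∧ ⟨K_z⟩βₘ`. -/
def kConj {Pred Cons : Type} (z : Var) (αs βs : List (Form Pred Cons)) :
    Form Pred Cons :=
  Form.bigAnd (αs.map (Form.K z) ++ βs.map (Form.diaK z))
theorem sat_bigAnd {Pred Cons D : Type} (k : ℕ) (I : Interp Pred Cons D)
    (Sit : Set (Assign D)) (sim : SimRel D) (σ : Assign D) (l : List (Form Pred Cons)) :
    Sat k I Sit sim σ (Form.bigAnd l) ↔ ∀ φ ∈ l, Sat k I Sit sim σ φ := by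
  induction l with
  | nil => simp [Form.bigAnd, Form.trueF, Form.falseF, Sat]
  | cons φ l ih => simp [Form.bigAnd, Sat, ih]

theorem sat_imp {Pred Cons D : Type} (k : ℕ) (I : Interp Pred Cons D)
    (Sit : Set (Assign D)) (sim : SimRel D) (σ : Assign D) (φ ψ : Form Pred Cons) :
    Sat k I Sit sim σ (φ.imp ψ) ↔ (Sat k I Sit sim σ φ → Sat k I Sit sim σ ψ) := by
  simp [Form.imp, Sat]

/-- The schema `(K_z T ∧ P(t₁,…,tₘ)) → K_z P(t₁,…,tₘ)` is true at
every situation of every `k`-sight model, whenever all the terms `t₁,…,tₘ` are in `T`. -/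
theorem structure_knowledge_valid {Pred Cons : Type} [Fintype Cons] [DecidableEq Cons]
    [Nonempty Cons] (k : ℕ) (D : Type) [Finite D] (I : Interp Pred Cons D)
    (Sit : Set (Assign D)) (sim : SimRel D)
    (hM : IsModel I Sit sim) (hK : KSight k I Sit sim)
    (σ : Assign D) (hσ : σ ∈ Sit) (z : Var)
    (P : Pred) (ts : List (Term Cons)) (T : Finset (Term Cons))
    (hts : ∀ t ∈ ts, t ∈ T) :
    Sat k I Sit sim σ
      (((Form.bigAnd (T.toList.map (Form.Kt z))).and (Form.pred P ts)).imp
        (Form.K z (Form.pred P ts))) := by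
  rw [sat_imp]
  simp only [Sat, sat_bigAnd]
  rintro ⟨hT, hP⟩ σ' hσ' hsim
  have hval : ts.map (Term.val I σ) = ts.map (Term.val I σ') :=
    List.map_congr_left fun t ht =>
      hT _ (List.mem_map_of_mem (Finset.mem_toList.mpr (hts t ht))) σ' hσ' hsim
  exact hval ▸ hP
end

section
/- Let M = (D, I, Σ, ∼) be a k-sight model, σ ∈ Σ, and {z,z'} = {x,y}. If M,σ ⊨ K_z z', then M,σ ⊨ [z]K_z z'. That is, after a player's own movement the player still knows the position of the other player if she knew it before. -/
/-- Every point lies in the ball of any radius around itself. -/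
theorem self_mem_Dball {Pred Cons D : Type} (I : Interp Pred Cons D) (m : ℕ) (s : D) :
    s ∈ Dball I m s := by
  induction m with
  | zero => exact rfl
  | succ m ih => exact Or.inl ih

/-- In a `k`-sight model every player knows its own position. -/
theorem KSight.eq_of_sim {Pred Cons D : Type} {k : ℕ} {I : Interp Pred Cons D}
    {Sit : Set (Assign D)} {sim : SimRel D} (hK : KSight k I Sit sim) {z : Var}
    {σ τ : Assign D} (hσ : σ ∈ Sit) (hτ : τ ∈ Sit) (h : sim z σ τ) : σ z = τ z :=
  hK z σ τ hσ hτ h z (self_mem_Dball I k (σ z))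

theorem Var.eq_or_eq_other (w z : Var) : w = z ∨ w = z.other := by
  cases w <;> cases z <;> simp [Var.other]

/-- If a player knows the position of the other player, then
after the player's own movement this is still the case: `K_z z' → [z]K_z z'`. -/
theorem movement_preserves_knowledge {Pred Cons : Type} [Fintype Cons] [DecidableEq Cons]
    [Nonempty Cons] (k : ℕ) (D : Type) [Finite D] (I : Interp Pred Cons D)
    (Sit : Set (Assign D)) (sim : SimRel D)
    (hM : IsModel I Sit sim) (hK : KSight k I Sit sim)
    (σ : Assign D) (hσ : σ ∈ Sit) (z : Var) :
    Sat k I Sit sim σ (Form.Kt z (Term.var z.other)) →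
    Sat k I Sit sim σ (Form.box z (Form.Kt z (Term.var z.other))) := by
  intro h σ₂ hstep σ' hσ' _
  change σ₂ z.other = σ' z.other
  rcases hσ' with ⟨_, rfl⟩ | ⟨_, ⟨τ, ⟨hτ, w, hw⟩, hτσ'⟩, _⟩
  · rfl
  · have hστ : σ z.other = τ z.other := by
      rcases Var.eq_or_eq_other w z with rfl | rfl
      · exact h τ hτ (hM.sim_symm _ _ _ hw)
      · exact hK.eq_of_sim hσ hτ hw
    rw [← hstep.2, hστ, hτσ'.2]
end

section
/- The schema [x][y]φ ↔ [Var]φ is not valid on k-sight models: there exist a 1-sight model M = (D, I, Σ, ∼) and a situation σ ∈ Σ such that M,σ ⊨ [x][y]K_x y but M,σ ⊭ [Var]K_x y. (Likewise [y][x]φ ↔ [Var]φ is not valid.) -/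
/-- The simultaneous-movement relation `R^{Var}`. -/
def RstepAll {Pred Cons D : Type} (I : Interp Pred Cons D) (σ σ' : Assign D) : Prop :=
  ∀ z : Var, I.rel (σ z) (σ' z)

/-- The updated set of situations after a simultaneous movement. -/
def updSitAll {Pred Cons D : Type} (k : ℕ) (I : Interp Pred Cons D)
    (Sit : Set (Assign D)) (sim : SimRel D) (σ₁ σ₂ : Assign D) : Set (Assign D) :=
  {σ' | (σ₂ Var.x ∈ Dball I k (σ₂ Var.y) ∧ σ' = σ₂) ∨
        (σ₂ Var.x ∉ Dball I k (σ₂ Var.y) ∧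
          (∃ σ ∈ restrict Sit sim σ₁, RstepAll I σ σ') ∧
          σ' Var.x ∉ Dball I k (σ' Var.y))}

/-- Satisfaction of the simultaneous-movement formula `[Var]φ`. -/
def SatBoxAll {Pred Cons D : Type} (k : ℕ) (I : Interp Pred Cons D)
    (Sit : Set (Assign D)) (sim : SimRel D) (σ : Assign D) (φ : Form Pred Cons) : Prop :=
  ∀ σ₂, RstepAll I σ σ₂ → Sat k I (updSitAll k I Sit sim σ σ₂) (updSim D) σ₂ φ

/-- The directed `5`-cycle, every point being its own name. -/
def cycleInterp : Interp Empty (Fin 5) (Fin 5) where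
  pred _ _ := False
  rel a b := b = a + 1
  const c := c

theorem mem_Dball_one_cycleInterp {s t : Fin 5} :
    t ∈ Dball cycleInterp 1 s ↔ t = s ∨ t = s + 1 ∨ s = t + 1 := by
  simp [Dball, cycleInterp]

/-- The situation with player `x` at `a` and player `y` at `b`. -/
def pairAssign {D : Type} (a b : D) : Assign D
  | .x => a
  | .y => b

theorem assign_ext {D : Type} {σ σ' : Assign D} (hx : σ .x = σ' .x) (hy : σ .y = σ' .y) :
    σ = σ' := by
  funext z
  cases z
  · exact hx
  · exact hy

/-- Player `x` is at `0`, player `y` is at `2` or `3`. -/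
def cycleSit : Set (Assign (Fin 5)) := {pairAssign 0 2, pairAssign 0 3}

/-- Each player knows exactly their own position. -/
def cycleSim : SimRel (Fin 5) := fun z σ σ' => σ ∈ cycleSit ∧ σ' ∈ cycleSit ∧ σ z = σ' z

theorem isModel_cycle : IsModel cycleInterp cycleSit cycleSim where
  serial s := ⟨s + 1, rfl⟩
  const_surj d := ⟨d, rfl⟩
  nonempty := ⟨pairAssign 0 2, Or.inl rfl⟩
  sim_mem _ _ _ h := ⟨h.1, h.2.1⟩
  sim_refl _ _ h := ⟨h, h, rfl⟩
  sim_symm _ _ _ h := ⟨h.2.1, h.1, h.2.2.symm⟩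
  sim_trans _ _ _ _ h h' := ⟨h.1, h'.2.1, h.2.2.trans h'.2.2⟩

theorem kSight_cycle : KSight 1 cycleInterp cycleSit cycleSim := by
  rintro z σ σ' hσ - ⟨-, -, hz⟩ z' hz'
  rw [mem_Dball_one_cycleInterp] at hz'
  rcases hσ with rfl | rfl <;> cases z <;> cases z' <;>
    first
    | exact hz
    | exact absurd hz' (by decide)

theorem eq_of_Rstep_x_cycle {a b : Fin 5} {σ : Assign (Fin 5)}
    (h : Rstep cycleInterp .x (pairAssign a b) σ) : σ = pairAssign (a + 1) b :=
  assign_ext h.1 h.2.symm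

theorem eq_of_Rstep_y_cycle {a b : Fin 5} {σ : Assign (Fin 5)}
    (h : Rstep cycleInterp .y (pairAssign a b) σ) : σ = pairAssign a (b + 1) :=
  assign_ext h.2.symm h.1

theorem RstepAll_cycle (a b : Fin 5) :
    RstepAll cycleInterp (pairAssign a b) (pairAssign (a + 1) (b + 1)) := by
  rintro (_ | _) <;> rfl

/-- If the move of `x` brings the players into sight, then `x` still knows where `y` is after
the forced move of `y`. -/
theorem sat_box_box_cycle :
    Sat 1 cycleInterp cycleSit cycleSim (pairAssign 0 2)
      (Form.box .x (Form.box .y (Form.Kt .x (Term.var .y)))) := by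
  intro σ₁ h₁ σ₂ h₂ σ' hσ' _
  obtain rfl := eq_of_Rstep_x_cycle h₁
  obtain rfl := eq_of_Rstep_y_cycle h₂
  rcases hσ' with ⟨-, rfl⟩ | ⟨-, ⟨τ, ⟨hτ, -⟩, hstep⟩, -⟩
  · rfl
  · rcases hτ with ⟨-, rfl⟩ | ⟨hfar, -⟩
    · rw [eq_of_Rstep_y_cycle hstep]
    · exact absurd (mem_Dball_one_cycleInterp.2 (by decide)) hfar

/-- When both players move at once they never see each other, so `x` cannot tell the two initial
positions of `y` apart. -/
theorem not_satBoxAll_cycle :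
    ¬ SatBoxAll 1 cycleInterp cycleSit cycleSim (pairAssign 0 2) (Form.Kt .x (Term.var .y)) := by
  intro h
  have hmem : pairAssign 1 4 ∈ updSitAll 1 cycleInterp cycleSit cycleSim
      (pairAssign 0 2) (pairAssign (0 + 1) (2 + 1)) := by
    refine Or.inr ⟨?_, ⟨pairAssign 0 3, ?_, RstepAll_cycle 0 3⟩, ?_⟩
    · rw [mem_Dball_one_cycleInterp]; decide
    · exact ⟨Or.inr rfl, .x, Or.inl rfl, Or.inr rfl, rfl⟩
    · rw [mem_Dball_one_cycleInterp]; decide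
  have heq : (3 : Fin 5) = 4 := h _ (RstepAll_cycle 0 2) _ hmem rfl
  exact absurd heq (by decide)

/-- The schema `[x][y]φ ↔ [Var]φ` is not valid on `k`-sight models:
there are a `1`-sight model and a situation where `[x][y]K_x y` holds but `[Var]K_x y` fails. -/
theorem box_seq_ne_box_sim :
    ∃ (Pred Cons D : Type) (_ : Fintype Cons) (_ : Nonempty Cons) (_ : Finite D)
      (I : Interp Pred Cons D) (Sit : Set (Assign D)) (sim : SimRel D) (σ : Assign D),
      IsModel I Sit sim ∧ KSight 1 I Sit sim ∧ σ ∈ Sit ∧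
      Sat 1 I Sit sim σ (Form.box .x (Form.box .y (Form.Kt .x (Term.var .y)))) ∧
      ¬ SatBoxAll 1 I Sit sim σ (Form.Kt .x (Term.var .y)) := by
  exact ⟨Empty, Fin 5, Fin 5, inferInstance, inferInstance, inferInstance, cycleInterp, cycleSit,
    cycleSim, pairAssign 0 2, isModel_cycle, kSight_cycle, Or.inl rfl, sat_box_box_cycle,
    not_satBoxAll_cycle⟩
end

section
/- In the proof system ELCR^-, for {z,z'} = {x,y} and every α ∈ L_B, the formula (K_z z' ∧ α) → K_z α is provable: ⊢ K_z z' ∧ α → K_z α. Moreover, the necessitation rule is derivable: from ⊢ α (α ∈ L_B) infer ⊢ K_z α. -/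
/-! ### The proof system ELCR⁻ -/

/-- Evaluation of a formula under a propositional valuation of its non-Boolean
components: used to define propositional tautologies. -/
def Form.evalProp {Pred Cons : Type} (v : Form Pred Cons → Prop) :
    Form Pred Cons → Prop
  | .neg φ => ¬ Form.evalProp v φ
  | .and φ ψ => Form.evalProp v φ ∧ Form.evalProp v ψ
  | φ => v φ

/-- Propositional tautologies. -/
def Form.Tautology {Pred Cons : Type} (φ : Form Pred Cons) : Prop :=
  ∀ v : Form Pred Cons → Prop, Form.evalProp v φ

/-- The Hilbert-style proof system `ELCR⁻` for the static fragment, with sight `k`. -/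
inductive Prov {Pred Cons : Type} [Fintype Cons] [DecidableEq Cons] (k : ℕ) :
    Form Pred Cons → Prop
  | taut {φ : Form Pred Cons} : φ.isStatic → φ.Tautology → Prov k φ
  | mp {φ ψ : Form Pred Cons} : Prov k (φ.imp ψ) → Prov k φ → Prov k ψ
  | eqRefl (t : Term Cons) : Prov k (.eq t t)
  | eqSymm (t₁ t₂ : Term Cons) : Prov k ((Form.eq t₁ t₂).imp (.eq t₂ t₁))
  | eqTrans (t₁ t₂ t₃ : Term Cons) :
      Prov k (((Form.eq t₁ t₂).and (.eq t₂ t₃)).imp (.eq t₁ t₃))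
  | eqSubst {α : Form Pred Cons} (t₁ t₂ : Term Cons) : α.isBase →
      Prov k ((Form.eq t₁ t₂).imp (α.iffF (α.replace t₁ t₂)))
  | seriality (c : Cons) :
      Prov k (Form.bigOr ((Finset.univ : Finset Cons).toList.map fun t =>
        Form.rel (.const c) (.const t)))
  | atSomewhere (z : Var) :
      Prov k (Form.bigOr ((Finset.univ : Finset Cons).toList.map fun c =>
        Form.eq (.var z) (.const c)))
  | ksight (z : Var) (t : Term Cons) :
      Prov k ((distForm Pred k (.var z) t).imp (.Kt z t))
  | kAx {α β : Form Pred Cons} (z : Var) : α.isBase → β.isBase →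
      Prov k ((Form.K z (α.imp β)).imp ((Form.K z α).imp (.K z β)))
  | tAx {α : Form Pred Cons} (z : Var) : α.isBase →
      Prov k ((Form.K z α).imp α)
  | kGround {α : Form Pred Cons} (z : Var) (T : Finset Cons) : α.isBase →
      Prov k ((KzEqSet z z.other T).imp
        ((Form.K z α).iffF (Form.bigAnd (T.toList.map fun c => α.substC c z.other))))
  | kAdd {α : Form Pred Cons} (z : Var) (αs βs : List (Form Pred Cons)) :
      α.isBase → (∀ γ ∈ αs, γ.isBase) → (∀ γ ∈ βs, γ.isBase) →
      1 ≤ αs.length + βs.length →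
      Prov k ((kConj z αs βs).imp α) → Prov k ((kConj z αs βs).imp (.K z α))
  | kElim {α β : Form Pred Cons} (z : Var) (αs βs : List (Form Pred Cons)) :
      α.isBase → β.isBase → (∀ γ ∈ αs, γ.isBase) → (∀ γ ∈ βs, γ.isBase) →
      1 ≤ αs.length + βs.length →
      Prov k ((kConj z.other αs βs).imp ((Form.K z α).imp β)) →
      Prov k ((kConj z.other αs βs).imp (α.imp β))
  | deRe (z : Var) (t : Term Cons) (c : Cons) :
      Prov k ((Form.eq t (.const c)).imp
        ((Form.Kt z t).iffF (.K z (.eq t (.const c)))))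
  | structK {α : Form Pred Cons} (z : Var) (T : Finset (Term Cons)) : α.isBase →
      (∀ t ∈ α.termList, t ∈ T) →
      Prov k (((Form.bigAnd (T.toList.map (Form.Kt z))).and α).imp (.K z α))

/-- A set of formulas is consistent if no finite conjunction from it proves `⊥`. -/
def consistentS {Pred Cons : Type} [Fintype Cons] [DecidableEq Cons] (k : ℕ)
    (Γ : Set (Form Pred Cons)) : Prop :=
  ¬ ∃ l : List (Form Pred Cons), (∀ φ ∈ l, φ ∈ Γ) ∧
      Prov k ((Form.bigAnd l).imp Form.falseF)

/-- Maximally consistent sets of `L⁻`-formulas. -/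
def MCS {Pred Cons : Type} [Fintype Cons] [DecidableEq Cons] (k : ℕ)
    (Δ : Set (Form Pred Cons)) : Prop :=
  consistentS k Δ ∧ (∀ φ ∈ Δ, Form.isStatic φ) ∧
    ∀ φ : Form Pred Cons, φ.isStatic → φ ∈ Δ ∨ Form.neg φ ∈ Δ

/-- All terms of the formula are constants. -/
def isConsOnly {Pred Cons : Type} (φ : Form Pred Cons) : Prop :=
  ∀ t ∈ φ.termList, ∃ c : Cons, t = Term.const c

/-- `Δ₁ =^Cons Δ₂`: the two sets contain the same `L_B`-formulas whose terms are
all constants. -/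
def consEq {Pred Cons : Type} (Δ₁ Δ₂ : Set (Form Pred Cons)) : Prop :=
  ∀ α : Form Pred Cons, α.isBase → isConsOnly α → (α ∈ Δ₁ ↔ α ∈ Δ₂)
namespace Form

variable {Pred Cons : Type}

theorem isBase.isStatic : ∀ {φ : Form Pred Cons}, φ.isBase → φ.isStatic
  | .pred _ _, _ => trivial
  | .rel _ _, _ => trivial
  | .eq _ _, _ => trivial
  | .neg φ, h => isBase.isStatic (φ := φ) h
  | .and φ ψ, h => ⟨isBase.isStatic (φ := φ) h.1, isBase.isStatic (φ := ψ) h.2⟩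

theorem isBase_bigOr {l : List (Form Pred Cons)} (h : ∀ φ ∈ l, φ.isBase) :
    (bigOr l).isBase := by
  induction l with
  | nil => trivial
  | cons φ l ih =>
    exact ⟨h φ List.mem_cons_self, ih fun ψ hψ => h ψ (List.mem_cons_of_mem _ hψ)⟩

theorem isStatic_bigAnd {l : List (Form Pred Cons)} (h : ∀ φ ∈ l, φ.isStatic) :
    (bigAnd l).isStatic := by
  induction l with
  | nil => trivial
  | cons φ l ih =>
    exact ⟨h φ List.mem_cons_self, ih fun ψ hψ => h ψ (List.mem_cons_of_mem _ hψ)⟩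

end Form

theorem isBase_distForm {Pred Cons : Type} [Fintype Cons] (n : ℕ) (t₁ t₂ : Term Cons) :
    (distForm Pred n t₁ t₂).isBase := by
  induction n generalizing t₂ with
  | zero => trivial
  | succ n ih =>
    refine ⟨ih t₂, Form.isBase_bigOr fun φ hφ => ?_⟩
    obtain ⟨t, -, rfl⟩ := List.mem_map.1 hφ
    exact ⟨ih t, trivial, trivial⟩

namespace Prov

variable {Pred Cons : Type} [Fintype Cons] [DecidableEq Cons] {k : ℕ}
  {φ ψ χ : Form Pred Cons}

theorem weaken (hφ : φ.isStatic) (hψ : ψ.isStatic) (h : Prov k ψ) : Prov k (φ.imp ψ) := by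
  refine mp (taut (φ := ψ.imp (φ.imp ψ)) ⟨hψ, hφ, hψ⟩ fun v => ?_) h
  simp only [Form.imp, Form.evalProp]
  tauto

theorem imp_trans (hφ : φ.isStatic) (hψ : ψ.isStatic) (hχ : χ.isStatic)
    (h₁ : Prov k (φ.imp ψ)) (h₂ : Prov k (ψ.imp χ)) : Prov k (φ.imp χ) := by
  refine mp (mp (taut (φ := (φ.imp ψ).imp ((ψ.imp χ).imp (φ.imp χ)))
    ⟨⟨hφ, hψ⟩, ⟨hψ, hχ⟩, hφ, hχ⟩ fun v => ?_) h₁) h₂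
  simp only [Form.imp, Form.evalProp]
  tauto

theorem imp_and (hφ : φ.isStatic) (hψ : ψ.isStatic) (hχ : χ.isStatic)
    (h₁ : Prov k (φ.imp ψ)) (h₂ : Prov k (φ.imp χ)) : Prov k (φ.imp (ψ.and χ)) := by
  refine mp (mp (taut (φ := (φ.imp ψ).imp ((φ.imp χ).imp (φ.imp (ψ.and χ))))
    ⟨⟨hφ, hψ⟩, ⟨hφ, hχ⟩, hφ, hψ, hχ⟩ fun v => ?_) h₁) h₂
  simp only [Form.imp, Form.evalProp]
  tauto

theorem and_left (hφ : φ.isStatic) (hψ : ψ.isStatic) : Prov k ((φ.and ψ).imp φ) :=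
  taut ⟨⟨hφ, hψ⟩, hφ⟩ fun v => by simp only [Form.imp, Form.evalProp]; tauto

theorem and_right (hφ : φ.isStatic) (hψ : ψ.isStatic) : Prov k ((φ.and ψ).imp ψ) :=
  taut ⟨⟨hφ, hψ⟩, hψ⟩ fun v => by simp only [Form.imp, Form.evalProp]; tauto

theorem or_inl (hφ : φ.isStatic) (hψ : ψ.isStatic) (h : Prov k φ) : Prov k (φ.or ψ) := by
  refine mp (taut (φ := φ.imp (φ.or ψ)) ⟨hφ, hφ, hψ⟩ fun v => ?_) h
  simp only [Form.imp, Form.or, Form.evalProp]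
  tauto

theorem of_iffF_right (hφ : φ.isStatic) (hψ : ψ.isStatic) (h : Prov k (φ.iffF ψ))
    (h' : Prov k ψ) : Prov k φ :=
  mp (mp (and_right (φ := φ.imp ψ) (ψ := ψ.imp φ) ⟨hφ, hψ⟩ ⟨hψ, hφ⟩) h) h'

theorem trueF : Prov k (Form.trueF : Form Pred Cons) := by
  refine mp (taut (φ := (Form.eq (.var .x) (.var .x)).imp Form.trueF) ⟨trivial, trivial⟩
    fun v => ?_) (eqRefl _)
  simp only [Form.imp, Form.trueF, Form.falseF, Form.evalProp]
  tauto

theorem imp_bigAnd {l : List (Form Pred Cons)} (hφ : φ.isStatic) (hl : ∀ ψ ∈ l, ψ.isStatic)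
    (h : ∀ ψ ∈ l, Prov k (φ.imp ψ)) : Prov k (φ.imp (Form.bigAnd l)) := by
  induction l with
  | nil => exact weaken hφ (by trivial) trueF
  | cons ψ l ih =>
    have hl' : ∀ χ ∈ l, χ.isStatic := fun χ hχ => hl χ (List.mem_cons_of_mem _ hχ)
    exact imp_and hφ (hl ψ List.mem_cons_self) (Form.isStatic_bigAnd hl')
      (h ψ List.mem_cons_self) (ih hl' fun χ hχ => h χ (List.mem_cons_of_mem _ hχ))

theorem distForm_self (n : ℕ) (t : Term Cons) : Prov k (distForm Pred n t t) := by
  induction n with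
  | zero => exact eqRefl t
  | succ n ih =>
    have h := (isBase_distForm (Pred := Pred) (n + 1) t t).isStatic
    exact or_inl h.1 h.2 ih

/-- Every player knows where they are. -/
theorem Kt_self (z : Var) : Prov k (Form.Kt z (.var z) : Form Pred Cons) :=
  mp (ksight z _) (distForm_self k _)

theorem K_eq_self (z : Var) :
    Prov k (Form.K z (.eq (.var z) (.var z)) : Form Pred Cons) := by
  let τ : Form Pred Cons := .eq (.var z) (.var z)
  have hs : ∀ ψ ∈ ({Term.var z} : Finset (Term Cons)).toList.map (Form.Kt (Pred := Pred) z),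
      ψ.isStatic := by
    intro ψ hψ
    obtain ⟨t, -, rfl⟩ := List.mem_map.1 hψ
    trivial
  have hK : Prov k (τ.imp (Form.bigAnd
      (({Term.var z} : Finset (Term Cons)).toList.map (Form.Kt z)))) := by
    refine imp_bigAnd (by trivial) hs fun ψ hψ => ?_
    obtain ⟨t, ht, rfl⟩ := List.mem_map.1 hψ
    obtain rfl : t = Term.var z := by simpa using ht
    exact weaken (by trivial) (by trivial) (Kt_self z)
  refine mp (imp_trans (φ := τ) (ψ := (Form.bigAnd _).and τ) (by trivial)
    ⟨Form.isStatic_bigAnd hs, trivial⟩ (by trivial) (imp_and (by trivial) (Form.isStatic_bigAnd hs) (by trivial) hK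
      (weaken (by trivial) (by trivial) (eqRefl _)))
    (structK (α := τ) z {Term.var z} trivial ?_)) (eqRefl _)
  simp [τ, Form.termList]

theorem necessitation (z : Var) (hφ : φ.isBase) (h : Prov k φ) : Prov k (Form.K z φ) := by
  let τ : Form Pred Cons := .eq (.var z) (.var z)
  have hs : (kConj z [τ] []).isStatic := ⟨trivial, trivial⟩
  refine mp (kAdd z [τ] [] hφ ?_ ?_ (by simp) (weaken hs hφ.isStatic h)) ?_
  · simp [τ, Form.isBase]
  · simp
  · exact mp (imp_and (φ := Form.K z τ) (by trivial) (by trivial) (by trivial)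
      (weaken (by trivial) (by trivial) (K_eq_self z))
      (weaken (by trivial) (by trivial) trueF)) (K_eq_self z)

theorem Kt_const (z : Var) (c : Cons) : Prov k (Form.Kt z (.const c) : Form Pred Cons) :=
  of_iffF_right (by trivial) (by trivial) (mp (deRe z (.const c) c) (eqRefl _))
    (necessitation z (by trivial) (eqRefl _))

theorem Kt_other_imp_Kt (z : Var) (t : Term Cons) :
    Prov k ((Form.Kt z (.var z.other) : Form Pred Cons).imp (.Kt z t)) := by
  rcases t with c | v
  · exact weaken (by trivial) (by trivial) (Kt_const z c)
  · have hv : v = z ∨ v = z.other := by cases v <;> cases z <;> simp [Var.other]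
    rcases hv with rfl | rfl
    · exact weaken (by trivial) (by trivial) (Kt_self _)
    · refine taut ⟨trivial, trivial⟩ fun v => ?_
      simp only [Form.imp, Form.evalProp]
      tauto

theorem Kt_other_and_imp_K (z : Var) (hφ : φ.isBase) :
    Prov k (((Form.Kt z (.var z.other)).and φ).imp (.K z φ)) := by
  have hp : ((Form.Kt z (.var z.other)).and φ).isStatic := ⟨trivial, hφ.isStatic⟩
  have hs : ∀ ψ ∈ φ.termList.toFinset.toList.map (Form.Kt (Pred := Pred) z),
      ψ.isStatic := by
    intro ψ hψ
    obtain ⟨t, -, rfl⟩ := List.mem_map.1 hψ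
    trivial
  refine imp_trans (ψ := (Form.bigAnd _).and φ) hp ⟨Form.isStatic_bigAnd hs, hφ.isStatic⟩ hφ
    (imp_and hp (Form.isStatic_bigAnd hs) hφ.isStatic (imp_bigAnd hp hs fun ψ hψ => ?_)
      (and_right (by trivial) hφ.isStatic))
    (structK z φ.termList.toFinset hφ fun t ht => List.mem_toFinset.2 ht)
  obtain ⟨t, -, rfl⟩ := List.mem_map.1 hψ
  exact imp_trans hp (by trivial) (by trivial) (and_left (by trivial) hφ.isStatic)
    (Kt_other_imp_Kt z t)

end Prov

/-- `⊢ K_z z' ∧ α → K_z α` for `α ∈ L_B` and `{z,z'} = {x,y}`,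
and derivability of the necessitation rule for `L_B`-formulas. -/
theorem prov_know_other_and_nec {Pred Cons : Type} [Fintype Cons] [DecidableEq Cons]
    [Nonempty Cons] (k : ℕ) :
    (∀ (z : Var) (α : Form Pred Cons), α.isBase →
      Prov k (((Form.Kt z (Term.var z.other)).and α).imp (Form.K z α))) ∧
    (∀ (z : Var) (α : Form Pred Cons), α.isBase →
      Prov k α → Prov k (Form.K z α)) :=
  ⟨fun z _ hα => Prov.Kt_other_and_imp_K z hα, fun z _ hα h => Prov.necessitation z hα h⟩
end
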